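/- Let S ⊂ V(G) and n ∈ ℕ, n ≥ 1, satisfy cl^n(S) = V(G), and suppose ω > 0 satisfies ω < (1/4)·(Σ_{j=0}^{n−1} (1/K_j)·∏_{i=j+1}^{n−1} (2·D_i/K_i + 1))^{−1}. Then for every f ∈ PW_ω(L): (Σ_{u∈S} |f(u)|²)^{1/2} ≤ ‖f‖ ≤ (1/(1−γ))·(∏_{i=0}^{n−1} (2·D_i/K_i + 1))^{1/2} · (Σ_{u∈S} |f(u)|²)^{1/2}, where γ = 2·ω^{1/2}·(Σ_{j=0}^{n−1} (1/K_j)·∏_{i=j+1}^{n−1} (2·D_i/K_i + 1))^{1/2} < 1. -/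

import Mathlib

open scoped BigOperators

variable {V : Type*}

noncomputable def lapl (G : SimpleGraph V) [DecidableRel G.Adj] [G.LocallyFinite]
    (f : V → ℂ) (v : V) : ℂ :=
  ∑ u ∈ G.neighborFinset v, (f v - f u)

noncomputable def l2norm (f : V → ℂ) : ℝ :=
  Real.sqrt (∑' v, ‖f v‖ ^ 2)

/-- The Paley–Wiener space `PW_ω(L)`: all `f ∈ L₂(G)` satisfying the Bernstein
inequality `‖L^k f‖ ≤ ω^k ‖f‖` for all `k ∈ ℕ`. -/
noncomputable def PW (G : SimpleGraph V) [DecidableRel G.Adj] [G.LocallyFinite] (ω : ℝ) :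
    Set (V → ℂ) :=
  {f | Memℓp f 2 ∧ ∀ k : ℕ, l2norm ((lapl G)^[k] f) ≤ ω ^ k * l2norm f}

def bdry (G : SimpleGraph V) (S : Set V) : Set V :=
  {v | v ∉ S ∧ ∃ u ∈ S, G.Adj u v}

def cl (G : SimpleGraph V) (S : Set V) : Set V := S ∪ bdry G S

noncomputable def Dm (G : SimpleGraph V) (S : Set V) (m : ℕ) : ℕ :=
  sSup ((fun v => {w | w ∈ bdry G ((cl G)^[m] S) ∧ G.Adj v w}.ncard) '' ((cl G)^[m] S))

noncomputable def Km (G : SimpleGraph V) (S : Set V) (m : ℕ) : ℕ :=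
  sInf ((fun v => {w | w ∈ (cl G)^[m] S ∧ G.Adj v w}.ncard) '' bdry G ((cl G)^[m] S))

section PairSums

variable (G : SimpleGraph V) [G.LocallyFinite]

/-- A function on ordered pairs that vanishes off the edges sums row by row over neighborhoods. -/
lemma hasSum_neighborFinset {F : V × V → ℝ} (hF : Summable F)
    (hsupp : ∀ v u, ¬ G.Adj v u → F (v, u) = 0) :
    HasSum (fun v => ∑ u ∈ G.neighborFinset v, F (v, u)) (∑' p, F p) := by
  refine hF.hasSum.prod_fiberwise fun v => hasSum_sum_of_ne_finset_zero fun u hu => ?_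
  exact hsupp v u (by simpa using hu)

lemma hasSum_neighborFinset_swap {F : V × V → ℝ} (hF : Summable F)
    (hsupp : ∀ v u, ¬ G.Adj v u → F (v, u) = 0) :
    HasSum (fun u => ∑ v ∈ G.neighborFinset u, F (v, u)) (∑' p, F p) := by
  have h := hasSum_neighborFinset G (F := fun p => F p.swap)
    ((Equiv.prodComm V V).summable_iff.mpr hF) fun v u h => hsupp u v fun h' => h h'.symm
  rwa [show ∑' p : V × V, F p.swap = ∑' p, F p from (Equiv.prodComm V V).tsum_eq F] at h

variable [DecidableRel G.Adj]

lemma summable_adj_fst {D : ℕ} (hD : ∀ v, G.degree v ≤ D) {N : V → ℝ} (hN : Summable N)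
    (h0 : ∀ v, 0 ≤ N v) :
    Summable fun p : V × V => if G.Adj p.1 p.2 then N p.1 else 0 := by
  have hrow : ∀ v, HasSum (fun u => if G.Adj v u then N v else 0) (G.degree v * N v) := by
    intro v
    have h := hasSum_sum_of_ne_finset_zero (f := fun u => if G.Adj v u then N v else 0)
      (s := G.neighborFinset v) (L := SummationFilter.unconditional V)
      fun u hu => if_neg (by simpa using hu)
    convert h using 1
    rw [Finset.sum_congr rfl fun u hu => if_pos ((G.mem_neighborFinset v u).mp hu)]
    simp
  rw [summable_prod_of_nonneg fun p => by dsimp only; split_ifs <;> simp [h0]]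
  refine ⟨fun v => (hrow v).summable, ?_⟩
  simp only [fun v => (hrow v).tsum_eq]
  refine Summable.of_nonneg_of_le (fun v => mul_nonneg (Nat.cast_nonneg _) (h0 v))
    (fun v => ?_) (hN.mul_left (D : ℝ))
  exact mul_le_mul_of_nonneg_right (by exact_mod_cast hD v) (h0 v)

lemma summable_adj_snd {D : ℕ} (hD : ∀ v, G.degree v ≤ D) {N : V → ℝ} (hN : Summable N)
    (h0 : ∀ v, 0 ≤ N v) :
    Summable fun p : V × V => if G.Adj p.1 p.2 then N p.2 else 0 := by
  have h := (Equiv.prodComm V V).summable_iff.mpr (summable_adj_fst G hD hN h0)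
  refine h.congr fun p => ?_
  simp [G.adj_comm]

end PairSums

section Energy

variable (G : SimpleGraph V) [DecidableRel G.Adj]

/-- The squared difference of `f` along an ordered pair of adjacent vertices. -/
noncomputable def edgeEnergy (f : V → ℂ) (p : V × V) : ℝ :=
  if G.Adj p.1 p.2 then ‖f p.1 - f p.2‖ ^ 2 else 0

lemma edgeEnergy_nonneg (f : V → ℂ) (p : V × V) : 0 ≤ edgeEnergy G f p := by
  unfold edgeEnergy; split_ifs <;> positivity

lemma norm_sub_sq_le_two (a b : ℂ) : ‖a - b‖ ^ 2 ≤ 2 * ‖a‖ ^ 2 + 2 * ‖b‖ ^ 2 := by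
  nlinarith [norm_sub_le a b, norm_nonneg (a - b), sq_nonneg (‖a‖ - ‖b‖), norm_nonneg a,
    norm_nonneg b]

variable [G.LocallyFinite]

lemma summable_edgeEnergy {D : ℕ} (hD : ∀ v, G.degree v ≤ D) {f : V → ℂ}
    (hf : Summable fun v => ‖f v‖ ^ 2) : Summable (edgeEnergy G f) := by
  have h1 := summable_adj_fst G hD hf fun v => by positivity
  have h2 := summable_adj_snd G hD hf fun v => by positivity
  refine Summable.of_nonneg_of_le (edgeEnergy_nonneg G f) (fun p => ?_)
    ((h1.mul_left 2).add (h2.mul_left 2))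
  unfold edgeEnergy
  split_ifs
  · exact norm_sub_sq_le_two _ _
  · simp

lemma summable_lapl_sq {D : ℕ} (hD : ∀ v, G.degree v ≤ D) {f : V → ℂ}
    (hf : Summable fun v => ‖f v‖ ^ 2) : Summable fun v => ‖lapl G f v‖ ^ 2 := by
  have hrow := (hasSum_neighborFinset G (summable_edgeEnergy G hD hf)
    fun v u h => if_neg h).summable
  refine Summable.of_nonneg_of_le (fun v => by positivity) (fun v => ?_)
    (hrow.mul_left (D : ℝ))
  have h1 : ‖lapl G f v‖ ≤ ∑ u ∈ G.neighborFinset v, ‖f v - f u‖ := norm_sum_le _ _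
  have h2 : ∑ u ∈ G.neighborFinset v, edgeEnergy G f (v, u)
      = ∑ u ∈ G.neighborFinset v, ‖f v - f u‖ ^ 2 :=
    Finset.sum_congr rfl fun u hu => if_pos ((G.mem_neighborFinset v u).mp hu)
  have h3 := sq_sum_le_card_mul_sum_sq (s := G.neighborFinset v) (f := fun u => ‖f v - f u‖)
  rw [G.card_neighborFinset_eq_degree] at h3
  rw [h2]
  refine (pow_le_pow_left₀ (norm_nonneg _) h1 2).trans (h3.trans ?_)
  exact mul_le_mul_of_nonneg_right (by exact_mod_cast hD v)
    (Finset.sum_nonneg fun u _ => by positivity)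

/-- The total energy over ordered pairs is twice the quadratic form of the Laplacian. -/
lemma hasSum_re_lapl_mul {D : ℕ} (hD : ∀ v, G.degree v ≤ D) {f : V → ℂ}
    (hf : Summable fun v => ‖f v‖ ^ 2) :
    HasSum (fun v => 2 * (lapl G f v * (starRingEnd ℂ) (f v)).re) (∑' p, edgeEnergy G f p) := by
  set F : V × V → ℝ := fun p =>
    if G.Adj p.1 p.2 then ((f p.1 - f p.2) * (starRingEnd ℂ) (f p.1)).re else 0 with hFdef
  have hF : Summable F := by
    refine Summable.of_norm_bounded
      ((summable_edgeEnergy G hD hf).add (summable_adj_fst G hD hf fun v => by positivity))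
      fun p => ?_
    simp only [hFdef, edgeEnergy]
    split_ifs
    · rw [Real.norm_eq_abs]
      refine (Complex.abs_re_le_norm _).trans ?_
      rw [norm_mul, RCLike.norm_conj]
      nlinarith [sq_nonneg (‖f p.1 - f p.2‖ - ‖f p.1‖), sq_nonneg ‖f p.1 - f p.2‖,
        sq_nonneg ‖f p.1‖]
    · simp
  have hswap : Summable fun p : V × V => F p.swap := (Equiv.prodComm V V).summable_iff.mpr hF
  have hE : ∀ p, edgeEnergy G f p = F p + F p.swap := by
    intro p
    simp only [hFdef, edgeEnergy, Prod.fst_swap, Prod.snd_swap, G.adj_comm p.2 p.1]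
    split_ifs
    · rw [← Complex.normSq_eq_norm_sq, Complex.normSq_apply]
      simp only [Complex.mul_re, Complex.sub_re, Complex.sub_im, Complex.conj_re,
        Complex.conj_im]
      ring
    · simp
  have hsum : ∑' p, edgeEnergy G f p = 2 * ∑' p, F p := by
    rw [tsum_congr hE, hF.tsum_add hswap,
      show ∑' p : V × V, F p.swap = ∑' p, F p from (Equiv.prodComm V V).tsum_eq F, two_mul]
  rw [hsum]
  refine HasSum.mul_left 2 ?_
  have hrow : ∀ v, (lapl G f v * (starRingEnd ℂ) (f v)).re
      = ∑ u ∈ G.neighborFinset v, F (v, u) := by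
    intro v
    rw [lapl, Finset.sum_mul, Complex.re_sum]
    exact Finset.sum_congr rfl fun u hu => (if_pos ((G.mem_neighborFinset v u).mp hu)).symm
  simp only [hrow]
  exact hasSum_neighborFinset G hF fun v u h => if_neg h

lemma summable_norm_sq_of_mem_PW {ω : ℝ} {f : V → ℂ} (hf : f ∈ PW G ω) :
    Summable fun v => ‖f v‖ ^ 2 := by
  have h := (memℓp_gen_iff (by norm_num)).mp hf.1
  simpa using h

lemma l2norm_sq (f : V → ℂ) : l2norm f ^ 2 = ∑' v, ‖f v‖ ^ 2 :=
  Real.sq_sqrt (tsum_nonneg fun _ => by positivity)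

lemma tsum_edgeEnergy_le_of_mem_PW {D : ℕ} (hD : ∀ v, G.degree v ≤ D) {ω : ℝ} (hω : 0 < ω)
    {f : V → ℂ} (hf : f ∈ PW G ω) :
    ∑' p, edgeEnergy G f p ≤ 2 * ω * l2norm f ^ 2 := by
  have hs := summable_norm_sq_of_mem_PW G hf
  have hL := summable_lapl_sq G hD hs
  have hB1 : l2norm (lapl G f) ≤ ω * l2norm f := by simpa using hf.2 1
  have hB : l2norm (lapl G f) ^ 2 ≤ (ω * l2norm f) ^ 2 :=
    pow_le_pow_left₀ (Real.sqrt_nonneg _) hB1 2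
  have hbound := (hL.hasSum.mul_left ω⁻¹).add (hs.hasSum.mul_left ω)
  rw [← l2norm_sq, ← l2norm_sq] at hbound
  have hle := hasSum_le (fun v => ?_) (hasSum_re_lapl_mul G hD hs) hbound
  · have : ω⁻¹ * l2norm (lapl G f) ^ 2 ≤ ω⁻¹ * (ω * l2norm f) ^ 2 := by gcongr
    have h' : ω⁻¹ * (ω * l2norm f) ^ 2 = ω * l2norm f ^ 2 := by field_simp
    linarith
  · have h1 : (lapl G f v * (starRingEnd ℂ) (f v)).re ≤ ‖lapl G f v‖ * ‖f v‖ := by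
      refine (Complex.re_le_norm _).trans ?_
      rw [norm_mul, RCLike.norm_conj]
    have h2 : ω⁻¹ * ‖lapl G f v‖ ^ 2 + ω * ‖f v‖ ^ 2 - 2 * (‖lapl G f v‖ * ‖f v‖)
        = ω⁻¹ * (‖lapl G f v‖ - ω * ‖f v‖) ^ 2 := by field_simp; ring
    have h3 : 0 ≤ ω⁻¹ * (‖lapl G f v‖ - ω * ‖f v‖) ^ 2 := by positivity
    linarith

end Energy

section Layers

lemma Km_le_ncard (G : SimpleGraph V) (S : Set V) (m : ℕ) {v : V} (hv : v ∈ bdry G ((cl G)^[m] S)) :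
    Km G S m ≤ {w | w ∈ (cl G)^[m] S ∧ G.Adj v w}.ncard :=
  Nat.sInf_le ⟨v, hv, rfl⟩

variable (G : SimpleGraph V) [G.LocallyFinite]

open Classical in
lemma ncard_mem_adj (T : Set V) (v : V) :
    {w | w ∈ T ∧ G.Adj v w}.ncard = ((G.neighborFinset v).filter (· ∈ T)).card := by
  rw [← Set.ncard_coe_finset]
  congr 1
  ext w
  simp [and_comm]

lemma ncard_bdry_adj_le_Dm {D : ℕ} (hD : ∀ v, G.degree v ≤ D) (S : Set V) (m : ℕ) {v : V}
    (hv : v ∈ (cl G)^[m] S) :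
    {w | w ∈ bdry G ((cl G)^[m] S) ∧ G.Adj v w}.ncard ≤ Dm G S m := by
  classical
  refine le_csSup ⟨D, ?_⟩ ⟨v, hv, rfl⟩
  rintro _ ⟨u, -, rfl⟩
  dsimp only
  rw [ncard_mem_adj]
  exact (Finset.card_filter_le _ _).trans ((G.card_neighborFinset_eq_degree u).trans_le (hD u))

lemma Km_pos (S : Set V) (m : ℕ) (hb : (bdry G ((cl G)^[m] S)).Nonempty) : 0 < Km G S m := by
  classical
  obtain ⟨v, hv, hKv⟩ := Nat.sInf_mem (hb.image fun v => {w | w ∈ (cl G)^[m] S ∧ G.Adj v w}.ncard)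
  rw [Km, ← hKv]
  dsimp only
  rw [ncard_mem_adj, Finset.card_pos]
  obtain ⟨-, u, hu, huv⟩ := hv
  exact ⟨u, by simp [hu, huv.symm]⟩

variable [DecidableRel G.Adj]

open Classical in
/-- Double counting of the edges between a set and its boundary layer. -/
lemma Km_mul_tsum_bdry_le {D : ℕ} (hD : ∀ v, G.degree v ≤ D) (S : Set V) (m : ℕ) {f : V → ℂ}
    (hf : Summable fun v => ‖f v‖ ^ 2) :
    (Km G S m : ℝ) * ∑' v, (bdry G ((cl G)^[m] S)).indicator (fun v => ‖f v‖ ^ 2) v ≤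
      2 * Dm G S m * ∑' v, ((cl G)^[m] S).indicator (fun v => ‖f v‖ ^ 2) v
        + 2 * ∑' p, edgeEnergy G f p := by
  set T := (cl G)^[m] S
  set F : V × V → ℝ := fun p =>
    if G.Adj p.1 p.2 then if p.1 ∈ bdry G T ∧ p.2 ∈ T then ‖f p.1‖ ^ 2 else 0 else 0 with hF
  set H : V × V → ℝ := fun p =>
    if G.Adj p.1 p.2 then if p.1 ∈ bdry G T ∧ p.2 ∈ T then ‖f p.2‖ ^ 2 else 0 else 0 with hH
  have hFs : Summable F := by
    refine Summable.of_nonneg_of_le (fun p => ?_) (fun p => ?_)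
      (summable_adj_fst G hD hf fun v => by positivity)
    all_goals simp only [hF]; split_ifs <;> first | exact le_rfl | positivity
  have hHs : Summable H := by
    refine Summable.of_nonneg_of_le (fun p => ?_) (fun p => ?_)
      (summable_adj_snd G hD hf fun v => by positivity)
    all_goals simp only [hH]; split_ifs <;> first | exact le_rfl | positivity
  have hEs := summable_edgeEnergy G hD hf
  have h1 : (Km G S m : ℝ) * ∑' v, (bdry G T).indicator (fun v => ‖f v‖ ^ 2) v ≤ ∑' p, F p := by
    refine hasSum_le (fun v => ?_) ((hf.indicator _).hasSum.mul_left _)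
      (hasSum_neighborFinset G hFs fun v u h => if_neg h)
    have hrow : ∑ u ∈ G.neighborFinset v, F (v, u)
        = ∑ u ∈ G.neighborFinset v, if v ∈ bdry G T ∧ u ∈ T then ‖f v‖ ^ 2 else 0 :=
      Finset.sum_congr rfl fun u hu => if_pos ((G.mem_neighborFinset v u).mp hu)
    rw [hrow]
    by_cases hv : v ∈ bdry G T
    · have hK := Km_le_ncard G S m hv
      rw [ncard_mem_adj] at hK
      simp only [hv, true_and, Set.indicator_of_mem, ← Finset.sum_filter, Finset.sum_const,
        nsmul_eq_mul]
      gcongr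
    · simp [hv]
  have h2 : ∑' p, F p ≤ 2 * ∑' p, H p + 2 * ∑' p, edgeEnergy G f p := by
    refine hasSum_le (fun p => ?_) hFs.hasSum
      ((hHs.hasSum.mul_left 2).add (hEs.hasSum.mul_left 2))
    simp only [hF, hH, edgeEnergy]
    split_ifs
    · have := norm_sub_sq_le_two (f p.1 - f p.2) (-f p.2)
      rw [sub_neg_eq_add, sub_add_cancel, norm_neg] at this
      linarith
    · positivity
    · simp
  have h3 : ∑' p, H p ≤ Dm G S m * ∑' v, T.indicator (fun v => ‖f v‖ ^ 2) v := by
    refine hasSum_le (fun u => ?_) (hasSum_neighborFinset_swap G hHs fun v u h => if_neg h)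
      ((hf.indicator _).hasSum.mul_left _)
    have hrow : ∑ v ∈ G.neighborFinset u, H (v, u)
        = ∑ v ∈ G.neighborFinset u, if v ∈ bdry G T ∧ u ∈ T then ‖f u‖ ^ 2 else 0 :=
      Finset.sum_congr rfl fun v hv => if_pos ((G.mem_neighborFinset u v).mp hv).symm
    rw [hrow]
    by_cases hu : u ∈ T
    · have hDm := ncard_bdry_adj_le_Dm G hD S m hu
      rw [ncard_mem_adj] at hDm
      simp only [hu, and_true, Set.indicator_of_mem, ← Finset.sum_filter, Finset.sum_const,
        nsmul_eq_mul]
      gcongr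
    · simp [hu]
  linarith

lemma tsum_cl_succ_le {D : ℕ} (hD : ∀ v, G.degree v ≤ D) (S : Set V) (m : ℕ) {f : V → ℂ}
    (hf : Summable fun v => ‖f v‖ ^ 2) :
    ∑' v, ((cl G)^[m + 1] S).indicator (fun v => ‖f v‖ ^ 2) v ≤
      (2 * (Dm G S m : ℝ) / (Km G S m : ℝ) + 1) *
          ∑' v, ((cl G)^[m] S).indicator (fun v => ‖f v‖ ^ 2) v
        + 2 * (∑' p, edgeEnergy G f p) * (1 / (Km G S m : ℝ)) := by
  have hcount := Km_mul_tsum_bdry_le G hD S m hf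
  have hEn : 0 ≤ ∑' p, edgeEnergy G f p := tsum_nonneg (edgeEnergy_nonneg G f)
  have hdisj : Disjoint ((cl G)^[m] S) (bdry G ((cl G)^[m] S)) :=
    Set.disjoint_left.mpr fun v hv hb => hb.1 hv
  have hsplit : ∑' v, ((cl G)^[m + 1] S).indicator (fun v => ‖f v‖ ^ 2) v =
      ∑' v, ((cl G)^[m] S).indicator (fun v => ‖f v‖ ^ 2) v
        + ∑' v, (bdry G ((cl G)^[m] S)).indicator (fun v => ‖f v‖ ^ 2) v := by
    rw [Function.iterate_succ_apply', cl, Set.indicator_union_of_disjoint hdisj,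
      ← (hf.indicator _).tsum_add (hf.indicator _)]
  have ha : 0 ≤ ∑' v, ((cl G)^[m] S).indicator (fun v => ‖f v‖ ^ 2) v :=
    tsum_nonneg fun v => Set.indicator_nonneg (fun _ _ => by positivity) v
  rw [hsplit]
  rcases Set.eq_empty_or_nonempty (bdry G ((cl G)^[m] S)) with hb | hb
  · simp only [hb, Set.indicator_empty, tsum_zero, add_zero]
    have h1 : 0 ≤ 2 * (Dm G S m : ℝ) / (Km G S m : ℝ) *
      ∑' v, ((cl G)^[m] S).indicator (fun v => ‖f v‖ ^ 2) v := by positivity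
    have h2 : 0 ≤ 2 * (∑' p, edgeEnergy G f p) * (1 / (Km G S m : ℝ)) := by positivity
    linarith
  · have hK : (0 : ℝ) < Km G S m := by exact_mod_cast Km_pos G S m hb
    rw [← le_div_iff₀' hK] at hcount
    refine (add_le_add_right hcount _).trans_eq ?_
    field_simp
    ring

end Layers

/-- A discrete Grönwall inequality for affine recursions. -/
lemma le_prod_mul_add_of_le_affine {a c k : ℕ → ℝ} {B : ℝ} (hc : ∀ m, 0 ≤ c m)
    (h : ∀ m, a (m + 1) ≤ c m * a m + B * k m) (n : ℕ) :
    a n ≤ (∏ i ∈ Finset.range n, c i) * a 0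
      + B * ∑ j ∈ Finset.range n, k j * ∏ i ∈ Finset.Ico (j + 1) n, c i := by
  induction n with
  | zero => simp
  | succ n ih =>
    have hsum : ∑ j ∈ Finset.range n, k j * ∏ i ∈ Finset.Ico (j + 1) (n + 1), c i
        = c n * ∑ j ∈ Finset.range n, k j * ∏ i ∈ Finset.Ico (j + 1) n, c i := by
      rw [Finset.mul_sum]
      refine Finset.sum_congr rfl fun j hj => ?_
      rw [Finset.prod_Ico_succ_top (by have := Finset.mem_range.mp hj; omega)]
      ring
    rw [Finset.prod_range_succ, Finset.sum_range_succ, hsum, Finset.Ico_self,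
      Finset.prod_empty, mul_one]
    have := mul_le_mul_of_nonneg_left ih (hc n)
    linarith [h n]

theorem stmt9 [Countable V] (G : SimpleGraph V) [DecidableRel G.Adj] [G.LocallyFinite]
    (hconn : G.Connected) (D : ℕ) (hD : ∀ v, G.degree v ≤ D)
    (S : Set V) (n : ℕ) (hn : 1 ≤ n)
    (hcover : (cl G)^[n] S = Set.univ)
    (ω : ℝ) (hω : 0 < ω)
    (hωsmall : ω < (1 / 4) * (∑ j ∈ Finset.range n, (1 / (Km G S j : ℝ)) *
        ∏ i ∈ Finset.Ico (j + 1) n, (2 * (Dm G S i : ℝ) / (Km G S i : ℝ) + 1))⁻¹)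
    (f : V → ℂ) (hf : f ∈ PW G ω)
    (γ : ℝ) (hγ : γ = 2 * Real.sqrt ω * Real.sqrt (∑ j ∈ Finset.range n,
        (1 / (Km G S j : ℝ)) *
        ∏ i ∈ Finset.Ico (j + 1) n, (2 * (Dm G S i : ℝ) / (Km G S i : ℝ) + 1))) :
    γ < 1 ∧
    Real.sqrt (∑' u : S, ‖f u‖ ^ 2) ≤ l2norm f ∧
    l2norm f ≤ (1 / (1 - γ)) *
      Real.sqrt (∏ i ∈ Finset.range n, (2 * (Dm G S i : ℝ) / (Km G S i : ℝ) + 1)) *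
      Real.sqrt (∑' u : S, ‖f u‖ ^ 2) := by
  have hs := summable_norm_sq_of_mem_PW G hf
  have hEn := tsum_edgeEnergy_le_of_mem_PW G hD hω hf
  have hS : ∑' u : S, ‖f u‖ ^ 2 = ∑' v, S.indicator (fun v => ‖f v‖ ^ 2) v :=
    tsum_subtype S fun v => ‖f v‖ ^ 2
  have hrec := le_prod_mul_add_of_le_affine
    (a := fun m => ∑' v, ((cl G)^[m] S).indicator (fun v => ‖f v‖ ^ 2) v)
    (c := fun m => 2 * (Dm G S m : ℝ) / (Km G S m : ℝ) + 1) (k := fun m => 1 / (Km G S m : ℝ))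
    (fun m => by positivity) (fun m => tsum_cl_succ_le G hD S m hs) n
  simp only [hcover, Set.indicator_univ, Function.iterate_zero, id_eq, ← hS] at hrec
  rw [← l2norm_sq f] at hrec
  set A := ∑' u : S, ‖f u‖ ^ 2
  set P := ∏ i ∈ Finset.range n, (2 * (Dm G S i : ℝ) / (Km G S i : ℝ) + 1)
  set Q := ∑ j ∈ Finset.range n, (1 / (Km G S j : ℝ)) *
    ∏ i ∈ Finset.Ico (j + 1) n, (2 * (Dm G S i : ℝ) / (Km G S i : ℝ) + 1)
  have hP0 : 0 ≤ P := Finset.prod_nonneg fun _ _ => by positivity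
  have hQ0 : 0 ≤ Q := Finset.sum_nonneg fun _ _ =>
    mul_nonneg (by positivity) (Finset.prod_nonneg fun _ _ => by positivity)
  have hγ0 : 0 ≤ γ := hγ ▸ by positivity
  have hγsq : γ ^ 2 = 4 * ω * Q := by
    rw [hγ, mul_pow, mul_pow, Real.sq_sqrt hω.le, Real.sq_sqrt hQ0]
    ring
  have hQpos : 0 < Q := by
    refine hQ0.lt_of_ne fun h => ?_
    rw [← h] at hωsmall
    simp at hωsmall
    linarith
  have hγ1 : γ < 1 := by
    rw [← div_eq_mul_inv, lt_div_iff₀ hQpos] at hωsmall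
    nlinarith
  refine ⟨hγ1, Real.sqrt_le_sqrt ?_, ?_⟩
  · rw [hS]
    exact (hs.indicator S).tsum_le_tsum
      (Set.indicator_le_self' fun _ _ => by positivity) hs
  · rw [mul_assoc, ← Real.sqrt_mul hP0, one_div, inv_mul_eq_div, le_div_iff₀ (by linarith)]
    refine Real.le_sqrt_of_sq_le ?_
    have hbound : l2norm f ^ 2 ≤ P * A + γ ^ 2 * l2norm f ^ 2 := by
      have := mul_le_mul_of_nonneg_right hEn hQ0
      rw [hγsq]
      linarith
    have hl2 := sq_nonneg (l2norm f)
    have hγ2 : (1 - γ) ^ 2 ≤ 1 - γ ^ 2 := by nlinarith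
    calc (l2norm f * (1 - γ)) ^ 2 = (1 - γ) ^ 2 * l2norm f ^ 2 := by ring
      _ ≤ (1 - γ ^ 2) * l2norm f ^ 2 := mul_le_mul_of_nonneg_right hγ2 hl2
      _ ≤ P * A := by linarith
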